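/- arXiv:math/9910052 — 2 statements merged into one kernel-verified Lean document; each statement's English description precedes it below -/
import Mathlib

section
/- Let g be an element of the even subalgebra CLIF₊(V) of the Clifford algebra. If g commutes with ι(v) for every v ∈ V, then g is a scalar, i.e. g = r·1 for some r ∈ ℝ. -/
open CliffordAlgebra
open scoped RealInnerProductSpace

/-- The supercommutator with a vector `v` is the contraction by the linear form `polar Q v`. -/
theorem ι_mul_sub_involute_mul_ι {R M : Type*} [CommRing R] [AddCommGroup M] [Module R M]
    (Q : QuadraticForm R M) (v : M) (x : CliffordAlgebra Q) :
    ι Q v * x - involute x * ι Q v = contractLeft (QuadraticMap.polarBilin Q v) x := by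
  induction x using CliffordAlgebra.left_induction with
  | algebraMap r =>
    rw [AlgHom.commutes, contractLeft_algebraMap, Algebra.commutes, sub_self]
  | add x y hx hy =>
    rw [map_add, map_add, ← hx, ← hy]
    noncomm_ring
  | ι_mul y w hy =>
    have h : ι Q v * ι Q w = algebraMap R _ (QuadraticMap.polar Q v w) - ι Q w * ι Q v :=
      eq_sub_of_add_eq (ι_mul_ι_add_swap v w)
    rw [contractLeft_ι_mul, ← hy, map_mul, involute_ι, ← mul_assoc, h, Algebra.smul_def,
      QuadraticMap.polarBilin_apply_apply]
    noncomm_ring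

namespace ExteriorAlgebra

variable {K M I : Type*} [Field K] [AddCommGroup M] [Module K M] [Fintype I]

/-- The Euler operator `∑ eᵢ ∧ (eᵢ* ⌋ x)` multiplies homogeneous elements by their degree. -/
theorem sum_ι_mul_contractLeft_of_mem (b : Module.Basis I K M) {n : ℕ} {x : ExteriorAlgebra K M}
    (hx : x ∈ LinearMap.range (ι K (M := M)) ^ n) :
    ∑ i, ι K (b i) * contractLeft (Q := (0 : QuadraticForm K M)) (b.coord i) x = (n : K) • x := by
  induction hx using Submodule.pow_induction_on_left' with
  | algebraMap r => simp [contractLeft_algebraMap (0 : QuadraticForm K M)]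
  | add x y n hx hy ihx ihy =>
    simp only [map_add, mul_add, Finset.sum_add_distrib, ihx, ihy, smul_add]
  | mem_mul m hm n y hy ih =>
    obtain ⟨v, rfl⟩ := hm
    have key (i : I) : ι K (b i) * contractLeft (Q := (0 : QuadraticForm K M)) (b.coord i)
        (ι K v * y) = ι K (b.repr v i • b i) * y
          + ι K v * (ι K (b i) * contractLeft (Q := (0 : QuadraticForm K M)) (b.coord i) y) := by
      have h : ι K (b i) * ι K v = -(ι K v * ι K (b i)) :=
        eq_neg_of_add_eq_zero_left (ι_add_mul_swap _ _)
      rw [contractLeft_ι_mul, mul_sub, ← mul_assoc, ← mul_assoc, h, map_smul, mul_smul_comm,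
        smul_mul_assoc, Module.Basis.coord_apply, neg_mul, sub_neg_eq_add]
    simp only [key, Finset.sum_add_distrib]
    rw [← Finset.sum_mul, ← map_sum, b.sum_repr, ← Finset.mul_sum, ih, mul_smul_comm,
      Nat.cast_succ, add_smul, one_smul, add_comm]

/-- In characteristic zero, an element of the exterior algebra of a finite-dimensional space that
is killed by all contractions is a scalar. -/
theorem exists_eq_algebraMap_of_contractLeft_eq_zero [CharZero K] (b : Module.Basis I K M)
    (x : ExteriorAlgebra K M)
    (hx : ∀ d : Module.Dual K M, contractLeft (Q := (0 : QuadraticForm K M)) d x = 0) :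
    ∃ r : K, x = algebraMap K (ExteriorAlgebra K M) r := by
  classical
  let A : ℕ → Submodule K (ExteriorAlgebra K M) := fun n ↦ ⋀[K]^n M
  have hsum : ∑ n ∈ (DirectSum.decompose A x).support,
      (n : K) • (DirectSum.decompose A x n : ExteriorAlgebra K M) = 0 := by
    have h : ∑ i, ι K (b i) * contractLeft (Q := (0 : QuadraticForm K M)) (b.coord i) x = 0 := by
      simp [hx]
    rw [← DirectSum.sum_support_decompose A x] at h
    simp only [map_sum, Finset.mul_sum] at h
    rw [Finset.sum_comm] at h
    rw [← h]
    exact Finset.sum_congr rfl fun n _ ↦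
      (sum_ι_mul_contractLeft_of_mem b (DirectSum.decompose A x n).2).symm
  have hzero (n : ℕ) (hn : n ≠ 0) : (DirectSum.decompose A x n : ExteriorAlgebra K M) = 0 := by
    by_contra hne
    have hmem : n ∈ (DirectSum.decompose A x).support := by
      simpa [DFinsupp.mem_support_iff] using hne
    have h := (iSupIndep_iff_finsetSum_eq_zero_imp_eq_zero A).1
      (DirectSum.Decomposition.isInternal A).submodule_iSupIndep _ _
      (fun i _ ↦ (A i).smul_mem (i : K) (DirectSum.decompose A x i).2) hsum n hmem
    exact (smul_eq_zero.1 h).elim (Nat.cast_ne_zero.2 hn) hne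
  have hx0 : x = DirectSum.decompose A x 0 := by
    conv_lhs => rw [← DirectSum.sum_support_decompose A x]
    refine Finset.sum_eq_single 0 (fun n _ hn ↦ hzero n hn) fun h ↦ ?_
    simpa using h
  obtain ⟨r, hr⟩ := Submodule.mem_one.mp (DirectSum.decompose A x 0).2
  exact ⟨r, hx0.trans hr.symm⟩

end ExteriorAlgebra

/-- If an element `g` of the even subalgebra `CLIF₊(V)` commutes with `ι(v)`
for every `v ∈ V`, then `g` is a scalar: `g = r • 1` for some `r : ℝ`. -/
theorem even_central_element_is_scalar
    (V : Type*) [NormedAddCommGroup V] [InnerProductSpace ℝ V] [FiniteDimensional ℝ V]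
    (Q : QuadraticForm ℝ V) (hQ : ∀ v : V, Q v = -⟪v, v⟫)
    (g : CliffordAlgebra Q) (hg : g ∈ evenOdd Q 0)
    (hcomm : ∀ v : V, g * ι Q v = ι Q v * g) :
    ∃ r : ℝ, g = algebraMap ℝ (CliffordAlgebra Q) r := by
  have hcontract (d : Module.Dual ℝ V) : contractLeft d g = 0 := by
    obtain ⟨v, rfl⟩ : ∃ v, QuadraticMap.polarBilin Q v = d := by
      let u := (InnerProductSpace.toDual ℝ V).symm (LinearMap.toContinuousLinearMap d)
      have hu (w : V) : ⟪u, w⟫ = d w := InnerProductSpace.toDual_symm_apply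
      refine ⟨(-(1 / 2) : ℝ) • u, LinearMap.ext fun w ↦ ?_⟩
      rw [QuadraticMap.polarBilin_apply_apply, QuadraticMap.polar, hQ, hQ, hQ,
        real_inner_add_add_self]
      have h : ⟪(-(1 / 2) : ℝ) • u, w⟫ = -(1 / 2) * d w := by rw [real_inner_smul_left, hu]
      linarith
    rw [← ι_mul_sub_involute_mul_ι, involute_eq_of_mem_even hg, hcomm, sub_self]
  let e := changeFormEquiv (changeForm.associated_neg_proof (Q := Q))
  obtain ⟨r, hr⟩ := ExteriorAlgebra.exists_eq_algebraMap_of_contractLeft_eq_zero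
    (Module.finBasis ℝ V) (e g) fun d ↦ by
      rw [changeFormEquiv_apply, ← changeForm_contractLeft, hcontract, map_zero]
  exact ⟨r, e.injective (hr.trans (changeForm_algebraMap changeForm.associated_neg_proof r).symm)⟩
end

section
/- For every natural number n, there is an isomorphism of ℂ-algebras ℂ ⊗_ℝ CLIF(ℝ^{n+2}) ≅ (ℂ ⊗_ℝ CLIF(ℝⁿ)) ⊗_ℂ M₂(ℂ), where M₂(ℂ) is the algebra of 2×2 complex matrices. -/
open scoped RealInnerProductSpace TensorProduct

section Anticommute

variable {A : Type*} [Ring A]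

theorem commute_mul_of_anticommute {e f g : A} (hf : f * e = -(e * f)) (hg : g * e = -(e * g)) :
    Commute e (f * g) := by
  rw [commute_iff_eq, mul_assoc f, hg, mul_neg, ← mul_assoc f, hf]
  simp [mul_assoc]

theorem mul_mul_mul_of_anticommute {f g : A} (hf : f * f = -1) (hg : g * g = -1)
    (hfg : g * f = -(f * g)) : f * g * (f * g) = -1 := by
  rw [mul_assoc, ← mul_assoc g, hfg, neg_mul, mul_assoc f g g, hg]
  simp [hf]

variable [Algebra ℂ A]

theorem I_smul_mul_mul_self {f g : A} (hf : f * f = -1) (hg : g * g = -1)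
    (hfg : g * f = -(f * g)) :
    (Complex.I • (f * g)) * (Complex.I • (f * g)) = 1 := by
  rw [smul_mul_smul_comm, mul_mul_mul_of_anticommute hf hg hfg]
  simp

theorem I_smul_mul_anticommute_left {f g : A} (hfg : g * f = -(f * g)) :
    (Complex.I • (f * g)) * f = -(f * (Complex.I • (f * g))) := by
  simp [mul_assoc, hfg]

theorem I_smul_mul_anticommute_right {f g : A} (hfg : g * f = -(f * g)) :
    (Complex.I • (f * g)) * g = -(g * (Complex.I • (f * g))) := by
  simp [← mul_assoc, hfg]

/-- The algebra hom `M₂(ℂ) → A` determined by two anticommuting square roots of `-1` in `A`. -/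
noncomputable def Matrix.liftOfAnticommute (f g : A)
    (hf : f * f = -1) (hg : g * g = -1) (hfg : g * f = -(f * g)) :
    Matrix (Fin 2) (Fin 2) ℂ →ₐ[ℂ] A :=
  AlgHom.ofLinearMap
    { toFun := fun M => ((M 0 0 + M 1 1) / 2) • (1 : A)
        + ((M 0 0 - M 1 1) / 2) • (Complex.I • (f * g))
        + (-Complex.I * (M 0 1 + M 1 0) / 2) • f + ((M 0 1 - M 1 0) / 2) • g
      map_add' := fun M N => by
        simp only [Matrix.add_apply]
        module
      map_smul' := fun c M => by
        simp only [Matrix.smul_apply, smul_eq_mul, RingHom.id_apply]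
        module }
    (by simp)
    (fun M N => by
      have h1 : f * g * f = g := by rw [mul_assoc, hfg, mul_neg, ← mul_assoc, hf]; simp
      have h2 : f * g * g = -f := by rw [mul_assoc, hg]; simp
      have h3 : f * (f * g) = -g := by rw [← mul_assoc, hf]; simp
      have h4 : g * (f * g) = f := by rw [← mul_assoc, hfg, neg_mul, h2, neg_neg]
      simp only [LinearMap.coe_mk, AddHom.coe_mk, Matrix.mul_apply, Fin.sum_univ_two, mul_add,
        add_mul, smul_smul, smul_mul_smul_comm, h1, h2, h3, h4,
        mul_mul_mul_of_anticommute hf hg hfg, hf, hg, hfg, mul_one, one_mul]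
      match_scalars <;> ring_nf <;> simp only [Complex.I_sq] <;> ring)

theorem Matrix.liftOfAnticommute_apply (f g : A)
    (hf : f * f = -1) (hg : g * g = -1) (hfg : g * f = -(f * g)) (M : Matrix (Fin 2) (Fin 2) ℂ) :
    Matrix.liftOfAnticommute f g hf hg hfg M = ((M 0 0 + M 1 1) / 2) • (1 : A)
      + ((M 0 0 - M 1 1) / 2) • (Complex.I • (f * g))
      + (-Complex.I * (M 0 1 + M 1 0) / 2) • f + ((M 0 1 - M 1 0) / 2) • g :=
  rfl

theorem Matrix.liftOfAnticommute_fst (f g : A)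
    (hf : f * f = -1) (hg : g * g = -1) (hfg : g * f = -(f * g)) :
    Matrix.liftOfAnticommute f g hf hg hfg !![0, Complex.I; Complex.I, 0] = f := by
  simp [Matrix.liftOfAnticommute_apply, mul_add]

theorem Matrix.liftOfAnticommute_snd (f g : A)
    (hf : f * f = -1) (hg : g * g = -1) (hfg : g * f = -(f * g)) :
    Matrix.liftOfAnticommute f g hf hg hfg !![0, 1; -1, 0] = g := by
  simp [Matrix.liftOfAnticommute_apply, show (1 + 1 : ℂ) / 2 = 1 by norm_num]

theorem Matrix.liftOfAnticommute_volume (f g : A)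
    (hf : f * f = -1) (hg : g * g = -1) (hfg : g * f = -(f * g)) :
    Matrix.liftOfAnticommute f g hf hg hfg !![1, 0; 0, -1] = Complex.I • (f * g) := by
  simp [Matrix.liftOfAnticommute_apply, show (1 + 1 : ℂ) / 2 = 1 by norm_num]

theorem Matrix.commute_liftOfAnticommute {e f g : A}
    (hf : f * f = -1) (hg : g * g = -1) (hfg : g * f = -(f * g))
    (hef : Commute e f) (heg : Commute e g) (M : Matrix (Fin 2) (Fin 2) ℂ) :
    Commute e (Matrix.liftOfAnticommute f g hf hg hfg M) := by
  rw [Matrix.liftOfAnticommute_apply]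
  exact ((((Commute.one_right _).smul_right _).add_right
    (((hef.mul_right heg).smul_right _).smul_right _)).add_right
    (hef.smul_right _)).add_right (heg.smul_right _)

/-- Algebra homs out of `M₂(ℂ)` are determined by the images of two anticommuting matrices. -/
theorem Matrix.algHom_ext_fin_two {F G : Matrix (Fin 2) (Fin 2) ℂ →ₐ[ℂ] A}
    (hX : F !![0, Complex.I; Complex.I, 0] = G !![0, Complex.I; Complex.I, 0])
    (hY : F !![0, 1; -1, 0] = G !![0, 1; -1, 0]) : F = G := by
  refine AlgHom.ext fun M => ?_
  have hM : M = ((M 0 0 + M 1 1) / 2) • (1 : Matrix (Fin 2) (Fin 2) ℂ)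
      + ((M 0 0 - M 1 1) / 2) • (Complex.I • (!![0, Complex.I; Complex.I, 0] * !![0, 1; -1, 0]))
      + (-Complex.I * (M 0 1 + M 1 0) / 2) • !![0, Complex.I; Complex.I, 0]
      + ((M 0 1 - M 1 0) / 2) • !![0, 1; -1, 0] := by
    ext i j
    fin_cases i <;> fin_cases j <;> simp <;> ring_nf <;> simp <;> ring
  rw [hM]
  simp only [map_add, map_smul, map_mul, map_one, hX, hY]

end Anticommute

theorem add_smul_add_smul_mul_self_of_anticommute {A : Type*} [Ring A] [Algebra ℝ A] {e f g : A}
    {q : ℝ} (he : e * e = algebraMap ℝ A q) (hf : f * f = -1) (hg : g * g = -1)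
    (hfe : f * e = -(e * f)) (hge : g * e = -(e * g)) (hgf : g * f = -(f * g)) (a b : ℝ) :
    (e + a • f + b • g) * (e + a • f + b • g)
      = algebraMap ℝ A (q + (-1 * (a * a) + -1 * (b * b))) := by
  simp only [mul_add, add_mul, smul_mul_assoc, mul_smul_comm, he, hf, hg, hfe, hge, hgf,
    Algebra.algebraMap_eq_smul_one]
  module

namespace CliffordAlgebra

section Commute

variable {R M A : Type*} [CommRing R] [AddCommGroup M] [Module R M] {Q : QuadraticForm R M}
  [Ring A] [Algebra R A]

theorem commute_map_of_commute_ι (φ : CliffordAlgebra Q →ₐ[R] A) {y : A}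
    (h : ∀ v, Commute (φ (ι Q v)) y) (x : CliffordAlgebra Q) : Commute (φ x) y := by
  induction x using CliffordAlgebra.induction with
  | algebraMap r => rw [φ.commutes]; exact Algebra.commutes r y
  | ι v => exact h v
  | mul a b ha hb => rw [map_mul]; exact ha.mul_left hb
  | add a b ha hb => rw [map_add]; exact ha.add_left hb

end Commute

section Complexification

variable {V : Type*} [AddCommGroup V] [Module ℝ V] (Q : QuadraticForm ℝ V)

/-- The inclusion of a real quadratic space in its complexified Clifford algebra. -/
noncomputable def complexι : V →ₗ[ℝ] ℂ ⊗[ℝ] CliffordAlgebra Q :=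
  TensorProduct.mk ℝ ℂ _ 1 ∘ₗ ι Q

theorem complexι_apply (v : V) : complexι Q v = 1 ⊗ₜ[ℝ] ι Q v :=
  rfl

theorem complexι_mul_self (v : V) : complexι Q v * complexι Q v = algebraMap ℝ _ (Q v) := by
  simp [complexι_apply, ι_sq_scalar, Algebra.algebraMap_eq_smul_one, Algebra.TensorProduct.one_def]

theorem complexι_mul_self_of_eq_neg_one {v : V} (h : Q v = -1) :
    complexι Q v * complexι Q v = -1 := by
  rw [complexι_mul_self, h, map_neg, map_one]

theorem complexι_mul_swap {v w : V} (h : QuadraticMap.polar Q w v = 0) :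
    complexι Q w * complexι Q v = -(complexι Q v * complexι Q w) := by
  have h' : ι Q w * ι Q v = -(ι Q v * ι Q w) := by
    rw [eq_neg_iff_add_eq_zero, ι_mul_ι_add_swap, h, map_zero]
  simp [complexι_apply, h', TensorProduct.tmul_neg]

/-- A real algebra hom from a Clifford algebra to a complex algebra extends to the
complexification. -/
noncomputable def complexLift {A : Type*} [Ring A] [Algebra ℂ A] [Algebra ℝ A]
    [IsScalarTower ℝ ℂ A] (φ : CliffordAlgebra Q →ₐ[ℝ] A) : ℂ ⊗[ℝ] CliffordAlgebra Q →ₐ[ℂ] A :=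
  Algebra.TensorProduct.lift (Algebra.ofId ℂ A) φ fun c x => by
    rw [Algebra.ofId_apply]
    exact Algebra.commute_algebraMap_left c (φ x)

variable {A : Type*} [Ring A] [Algebra ℂ A] [Algebra ℝ A] [IsScalarTower ℝ ℂ A]

theorem complexLift_tmul (φ : CliffordAlgebra Q →ₐ[ℝ] A) (c : ℂ) (x : CliffordAlgebra Q) :
    complexLift Q φ (c ⊗ₜ x) = algebraMap ℂ A c * φ x :=
  Algebra.TensorProduct.lift_tmul ..

theorem complexLift_complexι (φ : CliffordAlgebra Q →ₐ[ℝ] A) (v : V) :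
    complexLift Q φ (complexι Q v) = φ (ι Q v) := by
  rw [complexι_apply, complexLift_tmul, map_one, one_mul]

theorem complex_algHom_ext {B : Type*} [Ring B] [Algebra ℂ B]
    {F G : ℂ ⊗[ℝ] CliffordAlgebra Q →ₐ[ℂ] B}
    (h : ∀ v, F (complexι Q v) = G (complexι Q v)) : F = G :=
  Algebra.TensorProduct.ext (by ext) (CliffordAlgebra.hom_ext (LinearMap.ext h))

theorem commute_complexLift {φ : CliffordAlgebra Q →ₐ[ℝ] A} {y : A}
    (h : ∀ v, Commute (φ (ι Q v)) y) (x : ℂ ⊗[ℝ] CliffordAlgebra Q) :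
    Commute (complexLift Q φ x) y := by
  induction x with
  | zero => rw [map_zero]; exact Commute.zero_left y
  | add x y hx hy => rw [map_add]; exact hx.add_left hy
  | tmul c x =>
    rw [complexLift_tmul]
    exact (Algebra.commute_algebraMap_left c y).mul_left (commute_map_of_commute_ι φ h x)

end Complexification

variable {V : Type*} [AddCommGroup V] [Module ℝ V] (Q : QuadraticForm ℝ V)

/-- `Q` extended by the negative definite plane. -/
noncomputable abbrev prodPlane : QuadraticForm ℝ (V × ℝ × ℝ) :=
  Q.prod (CliffordAlgebraQuaternion.Q (-1) (-1))

section Lift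

variable {A : Type*} [Ring A] [Algebra ℝ A]

/-- The algebra hom out of the Clifford algebra of `Q` extended by a negative definite plane
determined by the images of the vectors of `V` and of the basis of the plane. -/
noncomputable def prodPlaneLift (E : V →ₗ[ℝ] A) (f g : A)
    (hE : ∀ v, E v * E v = algebraMap ℝ A (Q v)) (hf : f * f = -1) (hg : g * g = -1)
    (hfE : ∀ v, f * E v = -(E v * f)) (hgE : ∀ v, g * E v = -(E v * g))
    (hgf : g * f = -(f * g)) : CliffordAlgebra (prodPlane Q) →ₐ[ℝ] A :=
  lift (prodPlane Q)
    ⟨E.coprod ((LinearMap.toSpanSingleton ℝ A f).coprod (LinearMap.toSpanSingleton ℝ A g)),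
      fun v => by
        simpa [add_assoc] using add_smul_add_smul_mul_self_of_anticommute (hE v.1) hf hg
          (hfE v.1) (hgE v.1) hgf v.2.1 v.2.2⟩

theorem prodPlaneLift_ι (E : V →ₗ[ℝ] A) (f g : A)
    (hE : ∀ v, E v * E v = algebraMap ℝ A (Q v)) (hf : f * f = -1) (hg : g * g = -1)
    (hfE : ∀ v, f * E v = -(E v * f)) (hgE : ∀ v, g * E v = -(E v * g))
    (hgf : g * f = -(f * g)) (v : V × ℝ × ℝ) :
    prodPlaneLift Q E f g hE hf hg hfE hgE hgf (ι (prodPlane Q) v)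
      = E v.1 + v.2.1 • f + v.2.2 • g := by
  rw [prodPlaneLift, lift_ι_apply]
  simp [add_assoc]

end Lift

/-- The first basis vector of the plane, in the complexified Clifford algebra. -/
noncomputable def planeFst : ℂ ⊗[ℝ] CliffordAlgebra (prodPlane Q) :=
  complexι (prodPlane Q) (0, 1, 0)

/-- The second basis vector of the plane, in the complexified Clifford algebra. -/
noncomputable def planeSnd : ℂ ⊗[ℝ] CliffordAlgebra (prodPlane Q) :=
  complexι (prodPlane Q) (0, 0, 1)

theorem planeFst_mul_self : planeFst Q * planeFst Q = -1 :=
  complexι_mul_self_of_eq_neg_one _ (by simp)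

theorem planeSnd_mul_self : planeSnd Q * planeSnd Q = -1 :=
  complexι_mul_self_of_eq_neg_one _ (by simp)

theorem planeSnd_mul_planeFst : planeSnd Q * planeFst Q = -(planeFst Q * planeSnd Q) :=
  complexι_mul_swap _ (by simp [QuadraticMap.polar])

theorem complexι_inl_mul_inr (v : V) (w : ℝ × ℝ) :
    complexι (prodPlane Q) (v, 0) * complexι (prodPlane Q) (0, w)
      = -(complexι (prodPlane Q) (0, w) * complexι (prodPlane Q) (v, 0)) :=
  complexι_mul_swap _ (by simp [QuadraticMap.polar])

theorem complexι_inr_mul_inl (v : V) (w : ℝ × ℝ) :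
    complexι (prodPlane Q) (0, w) * complexι (prodPlane Q) (v, 0)
      = -(complexι (prodPlane Q) (v, 0) * complexι (prodPlane Q) (0, w)) :=
  complexι_mul_swap _ (by simp [QuadraticMap.polar])

/-- The embedding of `M₂(ℂ)` given by the negative definite plane. -/
noncomputable def matrixToProdPlane :
    Matrix (Fin 2) (Fin 2) ℂ →ₐ[ℂ] ℂ ⊗[ℝ] CliffordAlgebra (prodPlane Q) :=
  Matrix.liftOfAnticommute (planeFst Q) (planeSnd Q)
    (planeFst_mul_self Q) (planeSnd_mul_self Q) (planeSnd_mul_planeFst Q)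

/-- The complex volume element of the negative definite plane. -/
noncomputable def planeVolume : ℂ ⊗[ℝ] CliffordAlgebra (prodPlane Q) :=
  Complex.I • (planeFst Q * planeSnd Q)

theorem planeVolume_mul_self : planeVolume Q * planeVolume Q = 1 :=
  I_smul_mul_mul_self (planeFst_mul_self Q) (planeSnd_mul_self Q) (planeSnd_mul_planeFst Q)

theorem commute_complexι_planeVolume (v : V) :
    Commute (complexι (prodPlane Q) (v, 0)) (planeVolume Q) :=
  (commute_mul_of_anticommute (complexι_inr_mul_inl Q v _)
    (complexι_inr_mul_inl Q v _)).smul_right _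

theorem complexι_mul_planeVolume_mul_self (v : V) :
    complexι (prodPlane Q) (v, 0) * planeVolume Q * (complexι (prodPlane Q) (v, 0) * planeVolume Q)
      = algebraMap ℝ _ (Q v) := by
  rw [(commute_complexι_planeVolume Q v).symm.mul_mul_mul_comm, planeVolume_mul_self, mul_one,
    complexι_mul_self]
  simp

/-- The embedding of `CliffordAlgebra Q` that sends a vector `v` to `v` times the volume element
of the plane, so that its image commutes with the plane. -/
noncomputable def toProdPlane :
    CliffordAlgebra Q →ₐ[ℝ] ℂ ⊗[ℝ] CliffordAlgebra (prodPlane Q) :=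
  lift Q ⟨LinearMap.mulRight ℝ (planeVolume Q) ∘ₗ complexι (prodPlane Q) ∘ₗ
    LinearMap.inl ℝ V (ℝ × ℝ), complexι_mul_planeVolume_mul_self Q⟩

theorem toProdPlane_ι (v : V) :
    toProdPlane Q (ι Q v) = complexι (prodPlane Q) (v, 0) * planeVolume Q :=
  lift_ι_apply _ _ v

theorem commute_toProdPlane_ι_matrixToProdPlane (v : V) (M : Matrix (Fin 2) (Fin 2) ℂ) :
    Commute (toProdPlane Q (ι Q v)) (matrixToProdPlane Q M) := by
  rw [toProdPlane_ι]
  exact Matrix.commute_liftOfAnticommute _ _ _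
    (commute_mul_of_anticommute (complexι_inl_mul_inr Q v _)
      (I_smul_mul_anticommute_left (planeSnd_mul_planeFst Q))).symm
    (commute_mul_of_anticommute (complexι_inl_mul_inr Q v _)
      (I_smul_mul_anticommute_right (planeSnd_mul_planeFst Q))).symm M

/-- The complexified Clifford algebra tensored with the algebra of complex `2 × 2` matrices. -/
abbrev TensorMatrix : Type _ :=
  (ℂ ⊗[ℝ] CliffordAlgebra Q) ⊗[ℂ] Matrix (Fin 2) (Fin 2) ℂ

/-- The algebra hom from `(ℂ ⊗ CliffordAlgebra Q) ⊗ M₂(ℂ)` to the complexified Clifford algebra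
of `Q` extended by a negative definite plane. -/
noncomputable def ofTensorMatrix :
    TensorMatrix Q →ₐ[ℂ] ℂ ⊗[ℝ] CliffordAlgebra (prodPlane Q) :=
  Algebra.TensorProduct.lift (complexLift Q (toProdPlane Q)) (matrixToProdPlane Q) fun x M =>
    commute_complexLift Q (fun v => commute_toProdPlane_ι_matrixToProdPlane Q v M) x

theorem ofTensorMatrix_tmul (x : ℂ ⊗[ℝ] CliffordAlgebra Q) (M : Matrix (Fin 2) (Fin 2) ℂ) :
    ofTensorMatrix Q (x ⊗ₜ M) = complexLift Q (toProdPlane Q) x * matrixToProdPlane Q M :=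
  Algebra.TensorProduct.lift_tmul ..

theorem ofTensorMatrix_one_tmul (M : Matrix (Fin 2) (Fin 2) ℂ) :
    ofTensorMatrix Q (1 ⊗ₜ M) = matrixToProdPlane Q M := by
  rw [ofTensorMatrix_tmul, map_one, one_mul]

theorem ofTensorMatrix_complexι_tmul (v : V) (M : Matrix (Fin 2) (Fin 2) ℂ) :
    ofTensorMatrix Q (complexι Q v ⊗ₜ M)
      = complexι (prodPlane Q) (v, 0) * planeVolume Q * matrixToProdPlane Q M := by
  rw [ofTensorMatrix_tmul, complexLift_complexι, toProdPlane_ι]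

/-- The map sending a vector to its tensor product with the diagonal matrix `diag(1, -1)`. -/
noncomputable def vectorTMul : V →ₗ[ℝ] TensorMatrix Q :=
  ((TensorProduct.mk ℂ (ℂ ⊗[ℝ] CliffordAlgebra Q) (Matrix (Fin 2) (Fin 2) ℂ)).flip
    !![1, 0; 0, -1]).restrictScalars ℝ ∘ₗ complexι Q

theorem vectorTMul_apply (v : V) : vectorTMul Q v = complexι Q v ⊗ₜ !![1, 0; 0, -1] :=
  rfl

theorem vectorTMul_mul_self (v : V) :
    vectorTMul Q v * vectorTMul Q v = Algebra.ofId ℝ (TensorMatrix Q) (Q v) := by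
  simp [vectorTMul_apply, complexι_mul_self, ← Matrix.one_fin_two]

theorem one_tmul_mul_vectorTMul {M : Matrix (Fin 2) (Fin 2) ℂ}
    (hM : M * !![1, 0; 0, -1] = -(!![1, 0; 0, -1] * M)) (v : V) :
    (1 ⊗ₜ M : TensorMatrix Q) * vectorTMul Q v = -(vectorTMul Q v * (1 ⊗ₜ M)) := by
  simp [vectorTMul_apply, ← TensorProduct.tmul_neg, hM]

theorem one_tmul_mul_self {M : Matrix (Fin 2) (Fin 2) ℂ} (hM : M * M = -1) :
    (1 ⊗ₜ M : TensorMatrix Q) * (1 ⊗ₜ M) = -1 := by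
  simp [Algebra.TensorProduct.one_def, ← TensorProduct.tmul_neg, hM]

/-- The algebra hom from the Clifford algebra of `Q` extended by a negative definite plane to
`(ℂ ⊗ CliffordAlgebra Q) ⊗ M₂(ℂ)`. -/
noncomputable def prodPlaneToTensorMatrix :
    CliffordAlgebra (prodPlane Q) →ₐ[ℝ] TensorMatrix Q :=
  prodPlaneLift Q (A := TensorMatrix Q) (vectorTMul Q)
    (1 ⊗ₜ !![0, Complex.I; Complex.I, 0]) (1 ⊗ₜ !![0, 1; -1, 0])
    (vectorTMul_mul_self Q)
    (one_tmul_mul_self Q (by simp [Matrix.one_fin_two]))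
    (one_tmul_mul_self Q (by simp [Matrix.one_fin_two]))
    (one_tmul_mul_vectorTMul Q (by simp))
    (one_tmul_mul_vectorTMul Q (by simp))
    (by simp [← TensorProduct.tmul_neg])

/-- The algebra hom from the complexified Clifford algebra of `Q` extended by a negative definite
plane to `(ℂ ⊗ CliffordAlgebra Q) ⊗ M₂(ℂ)`. -/
noncomputable def toTensorMatrix :
    ℂ ⊗[ℝ] CliffordAlgebra (prodPlane Q) →ₐ[ℂ] TensorMatrix Q :=
  complexLift (prodPlane Q) (A := TensorMatrix Q) (prodPlaneToTensorMatrix Q)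

theorem toTensorMatrix_complexι (v : V × ℝ × ℝ) :
    toTensorMatrix Q (complexι (prodPlane Q) v) = complexι Q v.1 ⊗ₜ[ℂ] !![1, 0; 0, -1]
      + v.2.1 • (1 ⊗ₜ[ℂ] !![0, Complex.I; Complex.I, 0]) + v.2.2 • (1 ⊗ₜ[ℂ] !![0, 1; -1, 0]) :=
  (complexLift_complexι (prodPlane Q) (A := TensorMatrix Q) _ v).trans
    (prodPlaneLift_ι Q (A := TensorMatrix Q) ..)

theorem toTensorMatrix_planeFst :
    toTensorMatrix Q (planeFst Q) = 1 ⊗ₜ !![0, Complex.I; Complex.I, 0] := by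
  simp [planeFst, toTensorMatrix_complexι]

theorem toTensorMatrix_planeSnd : toTensorMatrix Q (planeSnd Q) = 1 ⊗ₜ !![0, 1; -1, 0] := by
  simp [planeSnd, toTensorMatrix_complexι]

theorem toTensorMatrix_planeVolume :
    toTensorMatrix Q (planeVolume Q) = 1 ⊗ₜ[ℂ] !![1, 0; 0, -1] := by
  rw [planeVolume, map_smul, map_mul, toTensorMatrix_planeFst, toTensorMatrix_planeSnd]
  simp [← TensorProduct.tmul_smul]

theorem toTensorMatrix_comp_ofTensorMatrix :
    (toTensorMatrix Q).comp (ofTensorMatrix Q) = AlgHom.id ℂ _ := by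
  have hM : ((toTensorMatrix Q).comp (ofTensorMatrix Q)).comp
      (Algebra.TensorProduct.includeRight :
        Matrix (Fin 2) (Fin 2) ℂ →ₐ[ℂ] TensorMatrix Q) = Algebra.TensorProduct.includeRight := by
    refine Matrix.algHom_ext_fin_two (A := TensorMatrix Q) ?_ ?_
    · refine (congrArg (toTensorMatrix Q) ((ofTensorMatrix_one_tmul Q _).trans ?_)).trans
        (toTensorMatrix_planeFst Q)
      exact Matrix.liftOfAnticommute_fst ..
    · refine (congrArg (toTensorMatrix Q) ((ofTensorMatrix_one_tmul Q _).trans ?_)).trans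
        (toTensorMatrix_planeSnd Q)
      exact Matrix.liftOfAnticommute_snd ..
  refine Algebra.TensorProduct.ext (complex_algHom_ext (B := TensorMatrix Q) Q fun v => ?_)
    (AlgHom.ext fun M => AlgHom.congr_fun hM M)
  change toTensorMatrix Q (ofTensorMatrix Q (complexι Q v ⊗ₜ 1)) = complexι Q v ⊗ₜ 1
  rw [ofTensorMatrix_complexι_tmul, map_one, mul_one, map_mul, toTensorMatrix_complexι,
    toTensorMatrix_planeVolume]
  simp [← Matrix.one_fin_two]

theorem ofTensorMatrix_comp_toTensorMatrix :
    (ofTensorMatrix Q).comp (toTensorMatrix Q) = AlgHom.id ℂ _ := by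
  refine complex_algHom_ext _ fun v => ?_
  have hX : matrixToProdPlane Q !![0, Complex.I; Complex.I, 0] = planeFst Q :=
    Matrix.liftOfAnticommute_fst ..
  have hY : matrixToProdPlane Q !![0, 1; -1, 0] = planeSnd Q :=
    Matrix.liftOfAnticommute_snd ..
  have hZ : matrixToProdPlane Q !![1, 0; 0, -1] = planeVolume Q :=
    Matrix.liftOfAnticommute_volume ..
  have hv : v = (v.1, 0) + v.2.1 • (0, 1, 0) + v.2.2 • (0, 0, 1) := by ext <;> simp
  rw [AlgHom.comp_apply, toTensorMatrix_complexι, map_add, map_add,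
    AlgHom.map_smul_of_tower, AlgHom.map_smul_of_tower, ofTensorMatrix_complexι_tmul,
    ofTensorMatrix_one_tmul, ofTensorMatrix_one_tmul, hX, hY, hZ, mul_assoc,
    planeVolume_mul_self, mul_one, AlgHom.id_apply]
  conv_rhs => rw [hv, map_add, map_add, map_smul, map_smul]
  rfl

/-- Extending a real quadratic space by a negative definite plane tensors the complexified Clifford
algebra with `M₂(ℂ)`. -/
noncomputable def equivTensorMatrix :
    (ℂ ⊗[ℝ] CliffordAlgebra (prodPlane Q)) ≃ₐ[ℂ] TensorMatrix Q :=
  AlgEquiv.ofAlgHom (toTensorMatrix Q) (ofTensorMatrix Q)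
    (toTensorMatrix_comp_ofTensorMatrix Q) (ofTensorMatrix_comp_toTensorMatrix Q)

end CliffordAlgebra

/-- Splitting off the first two coordinates of a euclidean space. -/
def EuclideanSpace.splitTwo (n : ℕ) :
    EuclideanSpace ℝ (Fin (n + 2)) ≃ₗ[ℝ] EuclideanSpace ℝ (Fin n) × ℝ × ℝ where
  toFun x := (WithLp.toLp 2 fun i => x i.succ.succ, x 0, x 1)
  invFun y := WithLp.toLp 2 (Fin.cons y.2.1 (Fin.cons y.2.2 y.1))
  map_add' _ _ := rfl
  map_smul' _ _ := rfl
  left_inv x := by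
    ext i
    refine Fin.cases rfl (fun i => Fin.cases rfl (fun i => rfl) i) i
  right_inv _ := rfl

theorem EuclideanSpace.splitTwo_apply (n : ℕ) (x : EuclideanSpace ℝ (Fin (n + 2))) :
    EuclideanSpace.splitTwo n x = (WithLp.toLp 2 fun i => x i.succ.succ, x 0, x 1) :=
  rfl

/-- `ℂ ⊗ CLIF(ℝ^{n+2}) ≅ (ℂ ⊗ CLIF(ℝⁿ)) ⊗ M₂(ℂ)` as `ℂ`-algebras,
where `CLIF(ℝᵐ)` is the Clifford algebra of the negative euclidean form `Q(x) = -‖x‖²`. -/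
theorem complexified_clifford_periodicity (n : ℕ)
    (Q : ∀ m : ℕ, QuadraticForm ℝ (EuclideanSpace ℝ (Fin m)))
    (hQ : ∀ (m : ℕ) (x : EuclideanSpace ℝ (Fin m)), Q m x = -⟪x, x⟫) :
    Nonempty ((ℂ ⊗[ℝ] CliffordAlgebra (Q (n + 2))) ≃ₐ[ℂ]
      ((ℂ ⊗[ℝ] CliffordAlgebra (Q n)) ⊗[ℂ] Matrix (Fin 2) (Fin 2) ℂ)) := by
  let e : (Q (n + 2)).IsometryEquiv (CliffordAlgebra.prodPlane (Q n)) :=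
    { EuclideanSpace.splitTwo n with
      map_app' := fun x => by
        change CliffordAlgebra.prodPlane (Q n) (EuclideanSpace.splitTwo n x) = Q (n + 2) x
        rw [EuclideanSpace.splitTwo_apply]
        simp only [QuadraticMap.prod_apply, CliffordAlgebraQuaternion.Q_apply, hQ,
          PiLp.inner_apply, Fin.sum_univ_succ (n := n + 1), Fin.sum_univ_succ (n := n)]
        simp
        ring }
  exact ⟨(Algebra.TensorProduct.congr AlgEquiv.refl (CliffordAlgebra.equivOfIsometry e)).trans
    (CliffordAlgebra.equivTensorMatrix (Q n))⟩
end
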